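/- arXiv:1512.07537 — 6 statements merged into one kernel-verified Lean document; each statement's English description precedes it below -/
import Mathlib

section
/- Let n ≥ 1, y_1, …, y_n ∈ ℝ, weights w_1, …, w_n > 0, and f(t) = max_{1≤i≤n} w_i·|t − y_i|. Suppose t_0 ∈ ℝ has critical points on both sides: there exist indices i and j with w_i·|t_0 − y_i| = f(t_0), w_j·|t_0 − y_j| = f(t_0), y_i ≤ t_0, and y_j ≥ t_0. Then t_0 is a global minimizer of f, i.e., f(t_0) ≤ f(t) for all t ∈ ℝ. -/
/-- If a height `t₀` has critical points on both sides (one at or below `t₀`,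
one at or above `t₀`), then `t₀` is a global minimizer of
`t ↦ max_i w i * |t - y i|`. -/
theorem critical_points_both_sides_optimal (n : ℕ) (hn : 1 ≤ n)
    (y w : Fin n → ℝ) (hw : ∀ i, 0 < w i) (t₀ : ℝ) (i j : Fin n)
    (hi : w i * |t₀ - y i| =
      Finset.univ.sup' ⟨(⟨0, hn⟩ : Fin n), Finset.mem_univ _⟩
        fun i' => w i' * |t₀ - y i'|)
    (hj : w j * |t₀ - y j| =
      Finset.univ.sup' ⟨(⟨0, hn⟩ : Fin n), Finset.mem_univ _⟩
        fun i' => w i' * |t₀ - y i'|)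
    (hyi : y i ≤ t₀) (hyj : t₀ ≤ y j) :
    ∀ t : ℝ,
      (Finset.univ.sup' ⟨(⟨0, hn⟩ : Fin n), Finset.mem_univ _⟩
        fun i' => w i' * |t₀ - y i'|) ≤
      (Finset.univ.sup' ⟨(⟨0, hn⟩ : Fin n), Finset.mem_univ _⟩
        fun i' => w i' * |t - y i'|) := by
  intro t
  rcases le_total t₀ t with ht | ht
  · rw [← hi]
    refine le_trans (mul_le_mul_of_nonneg_left ?_ (hw i).le)
      (Finset.le_sup' (fun i' => w i' * |t - y i'|) (Finset.mem_univ i))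
    rw [abs_of_nonneg (sub_nonneg.2 hyi), abs_of_nonneg (sub_nonneg.2 (hyi.trans ht))]
    linarith
  · rw [← hj]
    refine le_trans (mul_le_mul_of_nonneg_left ?_ (hw j).le)
      (Finset.le_sup' (fun i' => w i' * |t - y i'|) (Finset.mem_univ j))
    rw [abs_of_nonpos (sub_nonpos.2 hyj), abs_of_nonpos (sub_nonpos.2 (ht.trans hyj))]
    linarith
end

section
/- Let n ≥ 0 and k ≥ 1 be integers, and let 0 = a_0 ≤ a_1 ≤ … ≤ a_k = n and 0 = b_0 ≤ b_1 ≤ … ≤ b_k = n be the breakpoint sequences of two contiguous k-partitions of {1,…,n}, with parts P_j = {i : a_{j−1} < i ≤ a_j} and Q_j = {i : b_{j−1} < i ≤ b_j}. Then there exists an index j ∈ {1,…,k} with b_{j−1} ≤ a_{j−1} and a_j ≤ b_j, so that P_j ⊆ Q_j. In particular, if the first partition is balanced (a_j − a_{j−1} ≥ ⌊n/k⌋ for all j), then some part Q_j of the second partition contains a set of at least ⌊n/k⌋ consecutive indices forming a part of the first partition. -/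
/-- If `b 0 ≤ a 0` and `a k ≤ b k` with `1 ≤ k`, then some interval `[a (j-1), a j]` with
`1 ≤ j ≤ k` is contained in `[b (j-1), b j]`. -/
theorem exists_interval_le_interval {α : Type*} [LinearOrder α] {k : ℕ} (hk : 1 ≤ k)
    {a b : ℕ → α} (h0 : b 0 ≤ a 0) (hab : a k ≤ b k) :
    ∃ j, 1 ≤ j ∧ j ≤ k ∧ b (j - 1) ≤ a (j - 1) ∧ a j ≤ b j := by
  classical
  have hex : ∃ j, 1 ≤ j ∧ a j ≤ b j := ⟨k, hk, hab⟩
  obtain ⟨hj, hle⟩ := Nat.find_spec hex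
  refine ⟨Nat.find hex, hj, Nat.find_min' hex ⟨hk, hab⟩, ?_, hle⟩
  rcases hj.eq_or_lt with h | h
  · simpa [← h] using h0
  · by_contra! hlt
    exact Nat.find_min hex (Nat.sub_lt hj one_pos) ⟨Nat.le_sub_one_of_lt h, hlt.le⟩

/-- Given two contiguous `k`-partitions of `{1, …, n}` with breakpoint
sequences `a` and `b`, some part `P_j` of the first is contained in the
corresponding part `Q_j` of the second, i.e. `b (j-1) ≤ a (j-1)` and
`a j ≤ b j`.  In particular, if the first partition is balanced
(`⌊n/k⌋ ≤ a j - a (j-1)` for all `j`), then some part of the second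
partition contains a part of the first of at least `⌊n/k⌋` consecutive
indices. -/
theorem exists_big_partition_spanned (n k : ℕ) (hk : 1 ≤ k) (a b : ℕ → ℕ)
    (ha0 : a 0 = 0) (hak : a k = n) (hamono : ∀ j < k, a j ≤ a (j + 1))
    (hb0 : b 0 = 0) (hbk : b k = n) (hbmono : ∀ j < k, b j ≤ b (j + 1)) :
    (∃ j, 1 ≤ j ∧ j ≤ k ∧ b (j - 1) ≤ a (j - 1) ∧ a j ≤ b j) ∧
    ((∀ j, 1 ≤ j → j ≤ k → n / k ≤ a j - a (j - 1)) →
      ∃ j, 1 ≤ j ∧ j ≤ k ∧ b (j - 1) ≤ a (j - 1) ∧ a j ≤ b j ∧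
        n / k ≤ a j - a (j - 1)) := by
  obtain ⟨j, hj, hjk, hleft, hright⟩ :=
    exists_interval_le_interval hk (hb0.trans ha0.symm).le (hak.trans hbk.symm).le
  exact ⟨⟨j, hj, hjk, hleft, hright⟩,
    fun hbal => ⟨j, hj, hjk, hleft, hright, hbal j hj hjk⟩⟩
end

section
/- Let n ≥ 1 and k ≥ 1, and let y_1, …, y_n ∈ ℝ with weights w_1, …, w_n > 0. Then the optimal k-step cost is attained by some k-step function, and it equals the minimum over all contiguous k-partitions {P_1,…,P_k} of {1,…,n} of max_{1≤j≤k} r(P_j), where r(S) is the 1-center radius of S. -/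
/-- Maximum of a real-valued function over a finite set, with the maximum
over the empty set being `0`. -/
noncomputable def fmax {ι : Type*} (s : Finset ι) (f : ι → ℝ) : ℝ :=
  if h : s.Nonempty then s.sup' h f else 0

/-- The `j`-th part of the contiguous partition of points (indexed by
`Fin n`, point `i` being the `(i+1)`-st point) with breakpoints `a`:
the indices `i` with `a (j-1) < i + 1 ≤ a j`. -/
def part (n : ℕ) (a : ℕ → ℕ) (j : ℕ) : Finset (Fin n) :=
  Finset.univ.filter fun i => a (j - 1) ≤ (i : ℕ) ∧ (i : ℕ) < a j

/-- `a` is a breakpoint sequence for a contiguous partition into `steps`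
parts of the indices from `lo` to `hi`. -/
def IsBP (steps lo hi : ℕ) (a : ℕ → ℕ) : Prop :=
  a 0 = lo ∧ a steps = hi ∧ ∀ j < steps, a j ≤ a (j + 1)

/-- The cost of a set `S` of points at height `t`:
`max_{i ∈ S} w i * |t - y i|` (`0` if `S` is empty). -/
noncomputable def setCost (n : ℕ) (y w : Fin n → ℝ) (S : Finset (Fin n))
    (t : ℝ) : ℝ :=
  fmax S fun i => w i * |t - y i|

/-- The 1-center radius of a set `S` of points. -/
noncomputable def radius (n : ℕ) (y w : Fin n → ℝ) (S : Finset (Fin n)) : ℝ :=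
  ⨅ t : ℝ, setCost n y w S t

/-- The cost of the step function with breakpoints `a` and heights `h`,
using `steps` steps. -/
noncomputable def stepCost (n steps : ℕ) (y w : Fin n → ℝ) (a : ℕ → ℕ)
    (h : ℕ → ℝ) : ℝ :=
  fmax (Finset.Icc 1 steps) fun j => setCost n y w (part n a j) (h j)

/-- The optimal `steps`-step cost of the prefix consisting of the first
`hi` points. -/
noncomputable def optCost (n steps hi : ℕ) (y w : Fin n → ℝ) : ℝ :=
  sInf {D | ∃ a h, IsBP steps 0 hi a ∧ stepCost n steps y w a h = D}

theorem fmax_eq_sup' {ι : Type*} {s : Finset ι} (hs : s.Nonempty) (f : ι → ℝ) :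
    fmax s f = s.sup' hs f :=
  dif_pos hs

theorem le_fmax {ι : Type*} {s : Finset ι} (f : ι → ℝ) {i : ι} (hi : i ∈ s) :
    f i ≤ fmax s f := by
  rw [fmax_eq_sup' ⟨i, hi⟩]
  exact Finset.le_sup' f hi

theorem fmax_mono {ι : Type*} {s : Finset ι} {f g : ι → ℝ} (hfg : ∀ i ∈ s, f i ≤ g i) :
    fmax s f ≤ fmax s g := by
  rcases s.eq_empty_or_nonempty with rfl | hs
  · simp [fmax]
  · rw [fmax_eq_sup' hs, fmax_eq_sup' hs]
    exact Finset.sup'_mono_fun hfg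

theorem exists_mem_fmax_eq {ι : Type*} {s : Finset ι} (hs : s.Nonempty) (f : ι → ℝ) :
    ∃ i ∈ s, fmax s f = f i := by
  rw [fmax_eq_sup' hs]
  exact Finset.exists_mem_eq_sup' hs f

theorem exists_forall_setCost_le (n : ℕ) (y w : Fin n → ℝ) (hw : ∀ i, 0 < w i)
    (S : Finset (Fin n)) : ∃ t, ∀ u, setCost n y w S t ≤ setCost n y w S u := by
  rcases S.eq_empty_or_nonempty with rfl | hS
  · exact ⟨0, fun u => by simp [setCost, fmax]⟩
  · have hcont : Continuous (setCost n y w S) := by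
      have heq : setCost n y w S = fun t => S.sup' hS fun i => w i * |t - y i| :=
        funext fun t => fmax_eq_sup' hS _
      rw [heq]
      exact Continuous.finset_sup'_apply hS fun i _ => by fun_prop
    obtain ⟨i, hi⟩ := hS
    refine hcont.exists_forall_le (Filter.tendsto_atTop_mono
      (fun t => le_fmax (fun i => w i * |t - y i|) hi) ?_)
    refine Filter.Tendsto.const_mul_atTop (hw i) ?_
    simpa [Real.dist_eq] using tendsto_dist_right_cocompact_atTop (y i)

theorem exists_isLeast_setCost_radius (n : ℕ) (y w : Fin n → ℝ) (hw : ∀ i, 0 < w i)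
    (S : Finset (Fin n)) :
    ∃ t, setCost n y w S t = radius n y w S ∧ ∀ u, radius n y w S ≤ setCost n y w S u := by
  obtain ⟨t, ht⟩ := exists_forall_setCost_le n y w hw S
  have hbdd : BddBelow (Set.range (setCost n y w S)) :=
    ⟨setCost n y w S t, Set.forall_mem_range.2 ht⟩
  exact ⟨t, le_antisymm (le_ciInf ht) (ciInf_le hbdd t), ciInf_le hbdd⟩

theorem exists_isBP {k : ℕ} (hk : 1 ≤ k) (n : ℕ) : ∃ a, IsBP k 0 n a := by
  refine ⟨fun j => if j = 0 then 0 else n, by simp, by simp; omega, fun j _ => ?_⟩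
  by_cases hj : j = 0 <;> simp [hj]

theorem exists_isBP_forall_fmax_part_le (n : ℕ) {k : ℕ} (hk : 1 ≤ k)
    (r : Finset (Fin n) → ℝ) :
    ∃ a, IsBP k 0 n a ∧ ∀ a', IsBP k 0 n a' →
      fmax (Finset.Icc 1 k) (fun j => r (part n a j)) ≤
        fmax (Finset.Icc 1 k) (fun j => r (part n a' j)) := by
  have hfin : ((fun a => fmax (Finset.Icc 1 k) fun j => r (part n a j)) ''
      {a | IsBP k 0 n a}).Finite := by
    refine (Set.finite_range r).subset ?_
    rintro _ ⟨a, -, rfl⟩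
    obtain ⟨j, -, hj⟩ := exists_mem_fmax_eq (Finset.nonempty_Icc.2 hk) fun j => r (part n a j)
    exact ⟨part n a j, hj.symm⟩
  obtain ⟨_, ⟨a, ha, rfl⟩, hmin⟩ := Set.exists_min_image _ id hfin
    (Set.Nonempty.image _ (exists_isBP hk n))
  exact ⟨a, ha, fun a' ha' => hmin _ ⟨a', ha', rfl⟩⟩

/-- The optimal `k`-step cost is attained by some `k`-step function, and it
equals the minimum over all contiguous `k`-partitions of the maximum
1-center radius of a part. -/
theorem optimal_k_step_attained_eq_min_partition (n k : ℕ) (hn : 1 ≤ n)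
    (hk : 1 ≤ k) (y w : Fin n → ℝ) (hw : ∀ i, 0 < w i) :
    (∃ a h, IsBP k 0 n a ∧ stepCost n k y w a h = optCost n k n y w) ∧
    (∃ a, IsBP k 0 n a ∧
      optCost n k n y w =
        fmax (Finset.Icc 1 k) (fun j => radius n y w (part n a j)) ∧
      ∀ a', IsBP k 0 n a' →
        fmax (Finset.Icc 1 k) (fun j => radius n y w (part n a j)) ≤
          fmax (Finset.Icc 1 k) (fun j => radius n y w (part n a' j))) := by
  choose c hc hle using exists_isLeast_setCost_radius n y w hw
  obtain ⟨a, ha, hmin⟩ := exists_isBP_forall_fmax_part_le n hk (radius n y w)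
  have hcost : stepCost n k y w a (fun j => c (part n a j)) =
      fmax (Finset.Icc 1 k) (fun j => radius n y w (part n a j)) := by
    simp only [stepCost, hc]
  have hopt : optCost n k n y w =
      fmax (Finset.Icc 1 k) (fun j => radius n y w (part n a j)) := by
    refine IsLeast.csInf_eq ⟨⟨a, _, ha, hcost⟩, ?_⟩
    rintro _ ⟨a', h', ha', rfl⟩
    exact (hmin a' ha').trans (fmax_mono fun j _ => hle _ _)
  exact ⟨⟨a, _, ha, hcost.trans hopt.symm⟩, a, ha, hopt, hmin⟩
end

section
/- Let n ≥ 1 and k ≥ 1, let y_1, …, y_n ∈ ℝ with weights w_1, …, w_n > 0, and let D ≥ 0. Let m* be the largest m ∈ {1,…,n} such that the intersection ⋂_{i≤m} [y_i − D/w_i, y_i + D/w_i] is nonempty (m* exists since a single such interval is nonempty). Then {1,…,n} is D-feasible with k steps if and only if the suffix {m*+1, …, n} is D-feasible with k − 1 steps (the empty set being D-feasible with any number of steps, including zero). (Correctness of the greedy feasibility test that makes each step span a maximal prefix of the remaining points.) -/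
/-- The set of consecutive points with indices from `lo` (exclusive, in
1-based terms) to `hi` (inclusive) is `D`-feasible with `k` steps: there are
breakpoints `lo = a 0 ≤ a 1 ≤ … ≤ a k = hi` and heights `h 1, …, h k` such
that every point of the `j`-th block is within weighted distance `D` of
`h j`.  (Points are indexed by `Fin n`, point `i` being the `(i+1)`-st
point, so the block `(a (j-1), a j]` in 1-based terms consists of the
indices `i` with `a (j-1) ≤ i < a j`.) -/
def Feasible (n : ℕ) (y w : Fin n → ℝ) (lo hi k : ℕ) (D : ℝ) : Prop :=
  ∃ (a : ℕ → ℕ) (h : ℕ → ℝ), a 0 = lo ∧ a k = hi ∧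
    (∀ j < k, a j ≤ a (j + 1)) ∧
    ∀ j, 1 ≤ j → j ≤ k → ∀ i : Fin n, a (j - 1) ≤ (i : ℕ) → (i : ℕ) < a j →
      w i * |h j - y i| ≤ D

theorem mul_abs_sub_le_iff_mem_Icc {w y t D : ℝ} (hw : 0 < w) :
    w * |t - y| ≤ D ↔ t ∈ Set.Icc (y - D / w) (y + D / w) := by
  rw [mul_comm, ← le_div_iff₀ hw, abs_sub_le_iff, Set.mem_Icc]
  constructor <;> rintro ⟨h₁, h₂⟩ <;> constructor <;> linarith

theorem le_of_forall_lt_le_succ {a : ℕ → ℕ} {k : ℕ} (ha : ∀ j < k, a j ≤ a (j + 1))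
    {i : ℕ} (hi : i ≤ k) : a i ≤ a k := by
  induction k, hi using Nat.le_induction with
  | base => exact le_rfl
  | succ k _ ih =>
    exact (ih fun j hj => ha j (by omega)).trans (ha k (by omega))

/-- Correctness of the greedy feasibility test: if `m` is the largest index
in `{1, …, n}` such that `⋂_{i ≤ m} [y i - D / w i, y i + D / w i]` is
nonempty, then all `n` points are `D`-feasible with `k` steps iff the suffix
of points after `m` is `D`-feasible with `k - 1` steps. -/
theorem greedy_feasibility_test (n k : ℕ) (hn : 1 ≤ n) (hk : 1 ≤ k)
    (y w : Fin n → ℝ) (hw : ∀ i, 0 < w i) (D : ℝ) (hD : 0 ≤ D) (m : ℕ)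
    (hm1 : 1 ≤ m) (hmn : m ≤ n)
    (hcap : (⋂ (i : Fin n) (_ : (i : ℕ) < m),
      Set.Icc (y i - D / w i) (y i + D / w i)).Nonempty)
    (hmax : ∀ m', m < m' → m' ≤ n →
      ¬ (⋂ (i : Fin n) (_ : (i : ℕ) < m'),
        Set.Icc (y i - D / w i) (y i + D / w i)).Nonempty) :
    Feasible n y w 0 n k D ↔ Feasible n y w m n (k - 1) D := by
  obtain ⟨k, rfl⟩ : ∃ l, k = l + 1 := ⟨k - 1, by omega⟩
  rw [Nat.add_sub_cancel]
  constructor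
  · rintro ⟨a, h, ha0, hak, hmono, hcost⟩
    have ha1n : a 1 ≤ n := hak ▸ le_of_forall_lt_le_succ hmono hk
    have ha1m : a 1 ≤ m := by
      by_contra! hlt
      refine hmax (a 1) hlt ha1n ⟨h 1, Set.mem_iInter₂.2 fun i hi => ?_⟩
      exact (mul_abs_sub_le_iff_mem_Icc (hw i)).1 (hcost 1 le_rfl hk i (by simp [ha0]) hi)
    refine ⟨fun j => max m (a (j + 1)), fun j => h (j + 1), by simpa using ha1m,
      by simpa [hak] using hmn, fun j hj => max_le_max le_rfl (hmono (j + 1) (by omega)), ?_⟩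
    intro j hj hjk i hlo hhi
    dsimp only at hlo hhi
    rw [Nat.sub_add_cancel hj] at hlo
    exact hcost (j + 1) (by omega) (by omega) i (by rw [Nat.add_sub_cancel]; omega) (by omega)
  · rintro ⟨a, h, ha0, hak, hmono, hcost⟩
    obtain ⟨t, ht⟩ := hcap
    rw [Set.mem_iInter₂] at ht
    refine ⟨fun j => Nat.casesOn j 0 a, fun j => if j = 1 then t else h (j - 1), rfl, hak, ?_, ?_⟩
    · rintro (_ | j) hj
      · exact Nat.zero_le _
      · exact hmono j (by omega)
    · rintro (_ | _ | j) hj hjk i hlo hhi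
      · omega
      · simpa using (mul_abs_sub_le_iff_mem_Icc (hw i)).2 (ht i (ha0 ▸ hhi))
      · simpa using hcost (j + 1) (by omega) (by omega) i hlo hhi
end

section
/- Let y_1, …, y_n ∈ ℝ with weights w_1, …, w_n > 0, let a < b be anchors, and let m ∈ {0,…,n} be a split with C(m, b) = C*(b) that is maximal, i.e., C(m', b) > C(m, b) for every m' > m. Suppose max_{i≤m} w_i·|a − y_i| < max_{i>m} w_i·|b − y_i|, and there exists an index i > m with y_i > b whose cost achieves the right-side maximum, i.e., w_i·(y_i − b) = max_{i'>m} w_{i'}·|b − y_{i'}|. Then the optimal right anchor cannot lie below b: for every b' < b, C*(b') ≥ C*(b). -/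
/-- Cost of the left block `{1, …, m}` with the left anchor `a`:
`max_{i ≤ m} w i * |a - y i|` (points are indexed by `Fin n`, point `i`
being the `(i+1)`-st point). -/
noncomputable def leftCost (n : ℕ) (y w : Fin n → ℝ) (a : ℝ) (m : ℕ) : ℝ :=
  fmax (Finset.univ.filter fun i : Fin n => (i : ℕ) < m)
    fun i => w i * |a - y i|

/-- Cost of the right block `{m+1, …, n}` with the right anchor `b`:
`max_{i > m} w i * |b - y i|`. -/
noncomputable def rightCost (n : ℕ) (y w : Fin n → ℝ) (b : ℝ) (m : ℕ) : ℝ :=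
  fmax (Finset.univ.filter fun i : Fin n => m ≤ (i : ℕ))
    fun i => w i * |b - y i|

/-- The doubly anchored 2-step cost of the split `m ∈ {0, …, n}` with left
anchor `a` and right anchor `b`. -/
noncomputable def anchCost (n : ℕ) (y w : Fin n → ℝ) (a b : ℝ) (m : ℕ) : ℝ :=
  max (leftCost n y w a m) (rightCost n y w b m)

/-- The optimal doubly anchored 2-step cost `C*(b) = min_{0 ≤ m ≤ n} C(m, b)`. -/
noncomputable def anchOpt (n : ℕ) (y w : Fin n → ℝ) (a b : ℝ) : ℝ :=
  (Finset.range (n + 1)).inf' ⟨0, Finset.mem_range.mpr n.succ_pos⟩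
    (anchCost n y w a b)

/-- If an optimal, maximal split `m` for right anchor `b` has left cost
strictly smaller than the right cost, and some critical point of the right
block lies above `b`, then the optimal right anchor cannot lie below `b`. -/
theorem right_anchor_not_below (n : ℕ) (y w : Fin n → ℝ)
    (hw : ∀ i, 0 < w i) (a b : ℝ) (hab : a < b) (m : ℕ) (hmn : m ≤ n)
    (hopt : anchCost n y w a b m = anchOpt n y w a b)
    (hmaximal : ∀ m', m < m' → m' ≤ n →
      anchCost n y w a b m < anchCost n y w a b m')
    (hlt : leftCost n y w a m < rightCost n y w b m)
    (hcrit : ∃ i : Fin n, m ≤ (i : ℕ) ∧ b < y i ∧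
      w i * (y i - b) = rightCost n y w b m) :
    ∀ b' < b, anchOpt n y w a b ≤ anchOpt n y w a b' := by
  intro b' hb'
  obtain ⟨i, _, hbi, hi⟩ := hcrit
  have key : ∀ c < b, w i * (y i - b) ≤ w i * |c - y i| := fun c hc =>
    mul_le_mul_of_nonneg_left (by rw [abs_of_neg (by linarith)]; linarith) (hw i).le
  rw [← hopt, anchCost, max_eq_right hlt.le, ← hi]
  refine Finset.le_inf' _ _ fun k _ => ?_
  rcases lt_or_ge (i : ℕ) k with hik | hki
  · exact ((key a hab).trans
      (le_fmax (fun i => w i * |a - y i|) (by simpa using hik))).trans (le_max_left _ _)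
  · exact ((key b' hb').trans
      (le_fmax (fun i => w i * |b' - y i|) (by simpa using hki))).trans (le_max_right _ _)
end

section
/- Let y_1, …, y_n ∈ ℝ with weights w_1, …, w_n > 0, let a ∈ ℝ be a left anchor, and let m ∈ {0,…,n} be a split such that max_{i≤m} w_i·|a − y_i| < r({m+1,…,n}). Then some split m' ≥ m is optimal for the left-anchored 2-step problem: LA(a) = min_{m ≤ m' ≤ n} E(m'). (The first partition of an optimal left-anchored 2-step function contains the first m points.) -/
/-- The 1-center radius of the suffix `{m+1, …, n}`:
`inf_t max_{i > m} w i * |t - y i|`. -/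
noncomputable def suffixRadius (n : ℕ) (y w : Fin n → ℝ) (m : ℕ) : ℝ :=
  ⨅ t : ℝ, fmax (Finset.univ.filter fun i : Fin n => m ≤ (i : ℕ))
    fun i => w i * |t - y i|

/-- The left-anchored 2-step cost of the split `m ∈ {0, …, n}`:
`E(m) = max( max_{i ≤ m} w i * |a - y i|, r({m+1, …, n}) )`. -/
noncomputable def laCost (n : ℕ) (y w : Fin n → ℝ) (a : ℝ) (m : ℕ) : ℝ :=
  max (leftCost n y w a m) (suffixRadius n y w m)

/-- The optimal left-anchored 2-step cost `LA(a) = min_{0 ≤ m ≤ n} E(m)`. -/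
noncomputable def laOpt (n : ℕ) (y w : Fin n → ℝ) (a : ℝ) : ℝ :=
  (Finset.range (n + 1)).inf' ⟨0, Finset.mem_range.mpr n.succ_pos⟩
    (laCost n y w a)

lemma fmax_mono_of_nonneg {ι : Type*} {s t : Finset ι} {f : ι → ℝ}
    (hst : s ⊆ t) (hf : ∀ i, 0 ≤ f i) : fmax s f ≤ fmax t f := by
  unfold fmax
  by_cases hs : s.Nonempty
  · rw [dif_pos hs, dif_pos (hs.mono hst)]
    exact Finset.sup'_mono f hst hs
  · rw [dif_neg hs]
    split_ifs with ht
    · exact (hf _).trans (Finset.le_sup' f ht.choose_spec)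
    · exact le_rfl

lemma fmax_nonneg {ι : Type*} (s : Finset ι) {f : ι → ℝ} (hf : ∀ i, 0 ≤ f i) :
    0 ≤ fmax s f := by
  simpa [fmax] using fmax_mono_of_nonneg (Finset.empty_subset s) hf

lemma suffixRadius_antitone (n : ℕ) (y w : Fin n → ℝ) (hw : ∀ i, 0 ≤ w i) :
    Antitone (suffixRadius n y w) := by
  intro k m hkm
  have hcost : ∀ t i, 0 ≤ w i * |t - y i| := fun t i =>
    mul_nonneg (hw i) (abs_nonneg _)
  refine ciInf_mono ⟨0, ?_⟩ fun t => fmax_mono_of_nonneg ?_ (hcost t)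
  · rintro _ ⟨t, rfl⟩
    exact fmax_nonneg _ (hcost t)
  · exact Finset.monotone_filter_right _ fun _ _ hi => hkm.trans hi

/-- If at split `m` the left cost is strictly smaller than the 1-center
radius of the suffix, then some split `m' ≥ m` is optimal for the
left-anchored 2-step problem: the first part of an optimal left-anchored
2-step function contains the first `m` points. -/
theorem la_optimal_split_ge (n : ℕ) (y w : Fin n → ℝ) (hw : ∀ i, 0 < w i)
    (a : ℝ) (m : ℕ) (hmn : m ≤ n)
    (hlt : leftCost n y w a m < suffixRadius n y w m) :
    laOpt n y w a =
      (Finset.Icc m n).inf' ⟨m, Finset.mem_Icc.mpr ⟨le_rfl, hmn⟩⟩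
        (laCost n y w a) := by
  apply le_antisymm
  · refine Finset.inf'_mono _ (fun k hk => ?_) _
    exact Finset.mem_range.mpr (Nat.lt_succ_of_le (Finset.mem_Icc.mp hk).2)
  · refine Finset.le_inf' _ _ fun k hk => ?_
    rcases le_or_gt m k with hmk | hkm
    · exact Finset.inf'_le _
        (Finset.mem_Icc.mpr ⟨hmk, Nat.le_of_lt_succ (Finset.mem_range.mp hk)⟩)
    · calc
        _ ≤ laCost n y w a m :=
          Finset.inf'_le _ (Finset.mem_Icc.mpr ⟨le_rfl, hmn⟩)
        _ = suffixRadius n y w m := max_eq_right hlt.le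
        _ ≤ suffixRadius n y w k :=
          suffixRadius_antitone n y w (fun i => (hw i).le) hkm.le
        _ ≤ laCost n y w a k := le_max_right _ _
end
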